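/- arXiv:2509.11979 — 3 statements merged into one kernel-verified Lean document; each statement's English description precedes it below -/
import Mathlib

section
/- Fix n ≥ 1 and for ω ∈ {1,2,3}^n define E_ω(A) = ∑_{ε ∈ {−1,1}^n} ρ_{ε,ω} A ρ_{ε,ω}, where ρ_{ε,ω} = ⊗_{j=1}^n |e^{(ω_j)}_{ε_j}⟩⟨e^{(ω_j)}_{ε_j}|. Then for every α ∈ {0,1,2,3}^n, (1/3^n) ∑_{ω ∈ {1,2,3}^n} E_ω(σ_α) = 3^{−|α|} σ_α, where |α| = #{j : α_j ≠ 0}. Consequently, for any A = ∑_α Â_α σ_α one has (1/3^n) ∑_{ω ∈ {1,2,3}^n} E_ω(A) = ∑_α 3^{−|α|} Â_α σ_α. -/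
open scoped ComplexOrder

noncomputable def pauli : Fin 4 → Matrix (Fin 2) (Fin 2) ℂ :=
  ![1, !![0, 1; 1, 0], !![0, -Complex.I; Complex.I, 0], !![1, 0; 0, -1]]

abbrev QubitIdx (n : ℕ) := Fin n → Fin 2

/-- The Pauli monomial `σ_α = σ_{α 1} ⊗ ⋯ ⊗ σ_{α n}` as a matrix on `(ℂ²)^{⊗n}`. -/
noncomputable def pauliN (n : ℕ) (α : Fin n → Fin 4) :
    Matrix (QubitIdx n) (QubitIdx n) ℂ :=
  Matrix.of fun x y => ∏ j, pauli (α j) (x j) (y j)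

/-- `|α| = #{j : α_j ≠ 0}`. -/
def pweight {n : ℕ} (α : Fin n → Fin 4) : ℕ :=
  (Finset.univ.filter fun j => α j ≠ 0).card

/-- The Pauli coefficient `Â_α = 2^{-n} tr[σ_α A]`. -/
noncomputable def pauliCoeff {n : ℕ} (A : Matrix (QubitIdx n) (QubitIdx n) ℂ)
    (α : Fin n → Fin 4) : ℂ :=
  (pauliN n α * A).trace / 2 ^ n

/-- `A` has degree at most `d` in the Pauli expansion. -/
def DegLE {n : ℕ} (A : Matrix (QubitIdx n) (QubitIdx n) ℂ) (d : ℕ) : Prop :=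
  ∀ α : Fin n → Fin 4, d < pweight α → pauliCoeff A α = 0

/-- The operator norm of a matrix acting on Euclidean space. -/
noncomputable def opNorm {m : Type*} [Fintype m] [DecidableEq m]
    (A : Matrix m m ℂ) : ℝ :=
  ‖Matrix.toEuclideanCLM (𝕜 := ℂ) A‖

/-- The rank-one eigenprojection `|e^{(a)}_ε⟩⟨e^{(a)}_ε| = σ0/2 + ε σ_a/2` of the Pauli
matrix `σ_a`, `a ∈ {1,2,3}`, with eigenvalue `ε = ±1` (encoded by a `Bool`). -/
noncomputable def eigProj (a : Fin 3) (e : Bool) : Matrix (Fin 2) (Fin 2) ℂ :=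
  (1 / 2 : ℂ) • (1 : Matrix (Fin 2) (Fin 2) ℂ)
    + ((if e then 1 else -1 : ℂ) / 2) • pauli a.succ

/-- `ρ_{ε,ω} = ⊗_j |e^{(ω_j)}_{ε_j}⟩⟨e^{(ω_j)}_{ε_j}|`. -/
noncomputable def rhoState {n : ℕ} (ε : Fin n → Bool) (ω : Fin n → Fin 3) :
    Matrix (QubitIdx n) (QubitIdx n) ℂ :=
  Matrix.of fun x y => ∏ j, eigProj (ω j) (ε j) (x j) (y j)

/-- `E_ω(A) = ∑_{ε} ρ_{ε,ω} A ρ_{ε,ω}`. -/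
noncomputable def condExp {n : ℕ} (ω : Fin n → Fin 3)
    (A : Matrix (QubitIdx n) (QubitIdx n) ℂ) : Matrix (QubitIdx n) (QubitIdx n) ℂ :=
  ∑ ε : Fin n → Bool, rhoState ε ω * A * rhoState ε ω


/-- The tensor product of a family of `2 × 2` matrices. -/
noncomputable def tensorFamily {n : ℕ} (M : Fin n → Matrix (Fin 2) (Fin 2) ℂ) :
    Matrix (QubitIdx n) (QubitIdx n) ℂ :=
  Matrix.of fun x y => ∏ j, M j (x j) (y j)

theorem tensorFamily_mul {n : ℕ} (M N : Fin n → Matrix (Fin 2) (Fin 2) ℂ) :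
    tensorFamily M * tensorFamily N = tensorFamily fun j => M j * N j := by
  ext x y
  simp only [tensorFamily, Matrix.mul_apply, Matrix.of_apply, Finset.prod_univ_sum,
    Fintype.piFinset_univ, Finset.prod_mul_distrib]

theorem sum_tensorFamily {n : ℕ} {κ : Type*} [Fintype κ] [DecidableEq κ]
    (M : Fin n → κ → Matrix (Fin 2) (Fin 2) ℂ) :
    ∑ ω : Fin n → κ, tensorFamily (fun j => M j (ω j)) = tensorFamily fun j => ∑ k, M j k := by
  ext x y
  simp only [tensorFamily, Matrix.sum_apply, Matrix.of_apply, Finset.prod_univ_sum,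
    Fintype.piFinset_univ]

theorem tensorFamily_smul {n : ℕ} (a : Fin n → ℂ) (M : Fin n → Matrix (Fin 2) (Fin 2) ℂ) :
    tensorFamily (fun j => a j • M j) = (∏ j, a j) • tensorFamily M := by
  ext x y
  simp [tensorFamily, Finset.prod_mul_distrib]

theorem sum_eigProj_mul_pauli_mul_eigProj (b : Fin 4) :
    ∑ a, ∑ e, eigProj a e * pauli b * eigProj a e
      = (if b ≠ 0 then 1 else 3 : ℂ) • pauli b := by
  fin_cases b <;> ext i j <;> fin_cases i <;> fin_cases j <;>
    simp [Fin.sum_univ_three, eigProj, pauli, Matrix.mul_apply, Fin.sum_univ_two] <;>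
    ring_nf <;> simp <;> ring

theorem sum_condExp_pauliN {n : ℕ} (α : Fin n → Fin 4) :
    ∑ ω : Fin n → Fin 3, condExp ω (pauliN n α)
      = (∏ j, if α j ≠ 0 then 1 else 3 : ℂ) • pauliN n α := by
  calc ∑ ω : Fin n → Fin 3, condExp ω (pauliN n α)
      = ∑ ω : Fin n → Fin 3, tensorFamily fun j =>
          ∑ e, eigProj (ω j) e * pauli (α j) * eigProj (ω j) e := by
        refine Finset.sum_congr rfl fun ω _ => ?_
        rw [← sum_tensorFamily fun j e => eigProj (ω j) e * pauli (α j) * eigProj (ω j) e]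
        refine Finset.sum_congr rfl fun ε _ => ?_
        rw [← tensorFamily_mul, ← tensorFamily_mul]
        rfl
    _ = (∏ j, if α j ≠ 0 then 1 else 3 : ℂ) • pauliN n α := by
        rw [sum_tensorFamily fun j a => ∑ e, eigProj a e * pauli (α j) * eigProj a e]
        simp only [sum_eigProj_mul_pauli_mul_eigProj]
        exact tensorFamily_smul _ _

theorem inv_three_pow_mul_prod {n : ℕ} (α : Fin n → Fin 4) :
    ((3 : ℂ) ^ n)⁻¹ * ∏ j, (if α j ≠ 0 then 1 else 3 : ℂ) = ((3 : ℂ) ^ pweight α)⁻¹ := by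
  have h : (∏ j, (if α j ≠ 0 then 1 else 3 : ℂ)) * 3 ^ pweight α = 3 ^ n := by
    rw [pweight, ← Finset.prod_const, Finset.prod_filter, ← Finset.prod_mul_distrib]
    rw [Finset.prod_congr rfl (g := fun _ => (3 : ℂ)) fun j _ => by split_ifs <;> norm_num]
    simp
  rw [← h]
  have h3 : (3 : ℂ) ^ n ≠ 0 := by positivity
  rw [← h] at h3
  have := left_ne_zero_of_mul h3
  field_simp

theorem condExp_sum_smul {n : ℕ} {ι : Type*} [Fintype ι] (ω : Fin n → Fin 3) (c : ι → ℂ)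
    (B : ι → Matrix (QubitIdx n) (QubitIdx n) ℂ) :
    condExp ω (∑ i, c i • B i) = ∑ i, c i • condExp ω (B i) := by
  simp only [condExp, Finset.mul_sum, Finset.sum_mul, Finset.smul_sum, Matrix.mul_smul,
    Matrix.smul_mul]
  exact Finset.sum_comm

/-- `(1/3^n) ∑_{ω ∈ {1,2,3}^n} E_ω(σ_α) = 3^{−|α|} σ_α`, and consequently,
for `A = ∑_α Â_α σ_α`, `(1/3^n) ∑_ω E_ω(A) = ∑_α 3^{−|α|} Â_α σ_α`. -/
theorem average_condExp (n : ℕ) (hn : 1 ≤ n)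
    (A : Matrix (QubitIdx n) (QubitIdx n) ℂ) (c : (Fin n → Fin 4) → ℂ)
    (hA : A = ∑ α : Fin n → Fin 4, c α • pauliN n α) :
    (∀ α : Fin n → Fin 4,
      ((3 : ℂ) ^ n)⁻¹ • ∑ ω : Fin n → Fin 3, condExp ω (pauliN n α)
        = ((3 : ℂ) ^ pweight α)⁻¹ • pauliN n α) ∧
    ((3 : ℂ) ^ n)⁻¹ • ∑ ω : Fin n → Fin 3, condExp ω A
      = ∑ α : Fin n → Fin 4, ((3 : ℂ) ^ pweight α)⁻¹ • c α • pauliN n α := by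
  have h (α : Fin n → Fin 4) :
      ((3 : ℂ) ^ n)⁻¹ • ∑ ω : Fin n → Fin 3, condExp ω (pauliN n α)
        = ((3 : ℂ) ^ pweight α)⁻¹ • pauliN n α := by
    rw [sum_condExp_pauliN, smul_smul, inv_three_pow_mul_prod]
  refine ⟨h, ?_⟩
  subst hA
  simp only [condExp_sum_smul]
  rw [Finset.sum_comm, Finset.smul_sum]
  refine Finset.sum_congr rfl fun α _ => ?_
  rw [← Finset.smul_sum, smul_comm, h, smul_comm]
end

section
/- Let 0 ≤ k ≤ d ≤ n and let A be an operator on (ℂ²)^{⊗n} of degree at most d in the Pauli expansion. Then the level-k Rademacher projection Rad_k(A) = ∑_{|α| = k} Â_α σ_α satisfies ‖Rad_k(A)‖ ≤ (√2 + 1)^d ‖A‖, where ‖·‖ is the operator norm. -/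
open scoped ComplexOrder

/-- The level-`k` Rademacher projection `Rad_k(A) = ∑_{|α| = k} Â_α σ_α`. -/
noncomputable def radProj {n : ℕ} (k : ℕ)
    (A : Matrix (QubitIdx n) (QubitIdx n) ℂ) : Matrix (QubitIdx n) (QubitIdx n) ℂ :=
  ∑ α ∈ Finset.univ.filter (fun α : Fin n → Fin 4 => pweight α = k),
    pauliCoeff A α • pauliN n α

theorem norm_coeff_le_of_norm_sum_pow_smul_le {E : Type*} [NormedAddCommGroup E] [NormedSpace ℂ E]
    {d : ℕ} {a : ℕ → E} {M : ℝ} (hM : ∀ z : ℂ, ‖z‖ = 1 → ‖∑ k ∈ Finset.range (d + 1), z ^ k • a k‖ ≤ M)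
    {k : ℕ} (hk : k ≤ d) : ‖a k‖ ≤ M := by
  set N := d + 1 with hN
  have hζ := Complex.isPrimitiveRoot_exp N (by omega)
  set ζ := Complex.exp (2 * Real.pi * Complex.I / N)
  have hN0 : (N : ℂ) ≠ 0 := by simp [hN]; exact_mod_cast Nat.succ_ne_zero d
  have hζn : ‖ζ‖ = 1 := hζ.norm'_eq_one (by omega)
  have hζ0 : ζ ≠ 0 := hζ.ne_zero (by omega)
  have key : ∑ j ∈ Finset.range N, (ζ⁻¹ ^ (j * k)) • ∑ l ∈ Finset.range N, (ζ ^ j) ^ l • a l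
      = (N : ℂ) • a k := by
    simp_rw [Finset.smul_sum, smul_smul]
    rw [Finset.sum_comm]
    simp_rw [← Finset.sum_smul]
    rw [Finset.sum_eq_single k]
    · congr 1
      rw [Finset.sum_congr rfl (g := fun _ => 1)]
      · simp
      · intro j _
        rw [← pow_mul, ← mul_pow, inv_mul_cancel₀ hζ0, one_pow]
    · intro l hl hlk
      convert zero_smul ℂ (a l)
      have h1 : ∀ j, ζ⁻¹ ^ (j * k) * (ζ ^ j) ^ l = (ζ⁻¹ ^ k * ζ ^ l) ^ j := by
        intro j; rw [mul_pow, ← pow_mul, ← pow_mul, ← pow_mul, mul_comm j k, mul_comm j l]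
      simp_rw [h1]
      have h2 : ζ⁻¹ ^ k * ζ ^ l ≠ 1 := by
        intro h
        rw [inv_pow, inv_mul_eq_one₀ (pow_ne_zero _ hζ0)] at h
        exact hlk (hζ.pow_inj (by omega) (Finset.mem_range.1 hl) h).symm
      refine eq_zero_of_ne_zero_of_mul_right_eq_zero (sub_ne_zero.2 h2) ?_
      rw [geom_sum_mul, mul_pow, ← pow_mul, ← pow_mul, mul_comm k, mul_comm l, pow_mul, pow_mul,
        inv_pow, hζ.pow_eq_one]
      simp
    · intro h; simp at h; omega
  have h3 : ‖(N : ℂ) • a k‖ ≤ N * M := by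
    rw [← key]
    refine (norm_sum_le _ _).trans ?_
    refine (Finset.sum_le_card_nsmul _ _ M ?_).trans (by simp)
    intro j _
    rw [norm_smul]
    simpa [hζn] using hM (ζ ^ j) (by simp [hζn])
  rw [norm_smul, Complex.norm_natCast] at h3
  exact le_of_mul_le_mul_left h3 (by positivity)

theorem exists_sq_add_one_eq_two_mul {z : ℂ} (hz : ‖z‖ = 1) :
    ∃ w : ℂ, w ^ 2 + 1 = 2 * z * w ∧ ‖w‖ ≤ 1 ∧ Real.sqrt 2 - 1 ≤ ‖w‖ := by
  obtain ⟨w, hw, hw1⟩ : ∃ w : ℂ, w ^ 2 + 1 = 2 * z * w ∧ ‖w‖ ≤ 1 := by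
    obtain ⟨s, hs⟩ := IsAlgClosed.exists_pow_nat_eq (z ^ 2 - 1) (n := 2) (by norm_num)
    by_cases h : ‖z + s‖ ≤ 1
    · exact ⟨z + s, by linear_combination hs, h⟩
    · refine ⟨z - s, by linear_combination hs, ?_⟩
      have h1 : ‖z + s‖ * ‖z - s‖ = 1 := by
        rw [← norm_mul, show (z + s) * (z - s) = 1 by linear_combination -hs, norm_one]
      nlinarith [norm_nonneg (z - s)]
  refine ⟨w, hw, hw1, ?_⟩
  have h1 : (1 : ℝ) ≤ 2 * ‖w‖ + ‖w‖ ^ 2 := by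
    calc (1 : ℝ) = ‖2 * z * w - w ^ 2‖ := by
          rw [show 2 * z * w - w ^ 2 = 1 by linear_combination -hw, norm_one]
      _ ≤ _ := (norm_sub_le _ _).trans (by simp [hz])
  rw [sub_le_iff_le_add]
  exact Real.sqrt_le_iff.2 ⟨by positivity, by nlinarith⟩

/-- A polynomial of degree `d` bounded by `M` on `[-1, 1]` is bounded by `(√2 + 1) ^ d * M` on the
complex unit circle. -/
theorem norm_sum_pow_smul_le_of_norm_eq_one {E : Type*} [NormedAddCommGroup E] [NormedSpace ℂ E]
    {d : ℕ} {a : ℕ → E} {M : ℝ}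
    (hM : ∀ x : ℝ, |x| ≤ 1 → ‖∑ k ∈ Finset.range (d + 1), (x : ℂ) ^ k • a k‖ ≤ M)
    {z : ℂ} (hz : ‖z‖ = 1) :
    ‖∑ k ∈ Finset.range (d + 1), z ^ k • a k‖ ≤ (Real.sqrt 2 + 1) ^ d * M := by
  set q : ℂ → E := fun w =>
    ∑ k ∈ Finset.range (d + 1), (w ^ (d - k) * ((w ^ 2 + 1) / 2) ^ k) • a k with hq
  have hq_eq : ∀ {w t : ℂ}, w ^ 2 + 1 = 2 * t * w →
      q w = w ^ d • ∑ k ∈ Finset.range (d + 1), t ^ k • a k := by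
    intro w t h
    simp only [hq, Finset.smul_sum, smul_smul]
    refine Finset.sum_congr rfl fun k hk => ?_
    congr 1
    rw [h, ← Nat.sub_add_cancel (Nat.lt_succ_iff.1 (Finset.mem_range.1 hk)), pow_add]
    simp only [Nat.add_sub_cancel]
    rw [show 2 * t * w / 2 = t * w by ring, mul_pow]
    ring
  have hq_sphere : ∀ w : ℂ, ‖w‖ = 1 → ‖q w‖ ≤ M := by
    intro w hw
    have h : w ^ 2 + 1 = 2 * (w.re : ℂ) * w := by
      have h1 : w * (starRingEnd ℂ) w = 1 := by
        rw [Complex.mul_conj, Complex.normSq_eq_norm_sq, hw]; simp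
      have h2 := Complex.add_conj w
      push_cast at h2
      linear_combination w * h2 - h1
    rw [hq_eq h, norm_smul, norm_pow, hw, one_pow, one_mul]
    exact hM _ (hw ▸ Complex.abs_re_le_norm w)
  have hq_ball : ∀ w : ℂ, ‖w‖ ≤ 1 → ‖q w‖ ≤ M := by
    intro w hw
    refine Complex.norm_le_of_forall_mem_frontier_norm_le (U := Metric.ball (0 : ℂ) 1) (f := q)
      Metric.isBounded_ball (Differentiable.diffContOnCl (by fun_prop)) ?_ ?_
    · intro w hw
      rw [frontier_ball _ one_ne_zero] at hw
      exact hq_sphere w (by simpa using hw)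
    · rw [closure_ball _ one_ne_zero]; simpa using hw
  obtain ⟨w, hw, hw1, hw2⟩ := exists_sq_add_one_eq_two_mul hz
  have h := hq_ball w hw1
  rw [hq_eq hw, norm_smul, norm_pow] at h
  have hs : (Real.sqrt 2 + 1) * (Real.sqrt 2 - 1) = 1 := by
    nlinarith [Real.mul_self_sqrt (show (0:ℝ) ≤ 2 by norm_num)]
  have h1 : 1 ≤ (Real.sqrt 2 + 1) ^ d * ‖w‖ ^ d := by
    rw [← mul_pow]
    exact one_le_pow₀ (hs.symm.le.trans (by gcongr))
  calc _ ≤ ((Real.sqrt 2 + 1) ^ d * ‖w‖ ^ d) * ‖∑ k ∈ Finset.range (d + 1), z ^ k • a k‖ :=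
        le_mul_of_one_le_left (norm_nonneg _) h1
    _ ≤ _ := by rw [mul_assoc]; gcongr

section L2Norm

open scoped Matrix.Norms.L2Operator

theorem Matrix.l2_opNorm_map_star_le {m n : Type*} [Fintype m] [Fintype n] [DecidableEq n]
    (A : Matrix m n ℂ) : ‖A.map star‖ ≤ ‖A‖ := by
  rw [Matrix.l2_opNorm_def (A.map star)]
  refine ContinuousLinearMap.opNorm_le_bound _ (norm_nonneg _) fun x => ?_
  have h := Matrix.l2_opNorm_mulVec A (WithLp.toLp 2 (star x.ofLp))
  have h1 : ‖(WithLp.toLp 2 (star x.ofLp) : EuclideanSpace ℂ n)‖ = ‖x‖ := by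
    simp [EuclideanSpace.norm_eq]
  rw [h1] at h
  refine le_of_eq_of_le ?_ h
  simp only [EuclideanSpace.norm_eq]
  congr 1
  refine Finset.sum_congr rfl fun i _ => ?_
  congr 1
  rw [← norm_star]
  simp [Matrix.toLpLin_apply, Matrix.mulVec, dotProduct]

theorem Matrix.l2_opNorm_transpose_le {m n : Type*} [Fintype m] [Fintype n] [DecidableEq m]
    [DecidableEq n] (A : Matrix m n ℂ) : ‖A.transpose‖ ≤ ‖A‖ := by
  rw [← Matrix.l2_opNorm_conjTranspose A]
  convert Matrix.l2_opNorm_map_star_le A.conjTranspose using 2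
  ext i j
  simp

end L2Norm

/-- The tensor product of a family of `2 × 2` matrices. -/
def tensorN {n : ℕ} (M : Fin n → Matrix (Fin 2) (Fin 2) ℂ) :
    Matrix (QubitIdx n) (QubitIdx n) ℂ :=
  Matrix.of fun x y => ∏ j, M j (x j) (y j)

theorem pauliN_eq_tensorN (n : ℕ) (α : Fin n → Fin 4) :
    pauliN n α = tensorN fun j => pauli (α j) := rfl

theorem tensorN_mul {n : ℕ} (M N : Fin n → Matrix (Fin 2) (Fin 2) ℂ) :
    tensorN M * tensorN N = tensorN fun j => M j * N j := by
  ext x y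
  simp only [tensorN, Matrix.mul_apply, Matrix.of_apply, ← Finset.prod_mul_distrib]
  rw [Finset.prod_univ_sum, Fintype.piFinset_univ]

theorem tensorN_smul {n : ℕ} (c : Fin n → ℂ) (M : Fin n → Matrix (Fin 2) (Fin 2) ℂ) :
    (tensorN fun j => c j • M j) = (∏ j, c j) • tensorN M := by
  ext x y
  simp [tensorN, Finset.prod_mul_distrib]

theorem tensorN_one (n : ℕ) : (tensorN fun _ : Fin n => 1) = 1 := by
  ext x y
  simp only [tensorN, Matrix.of_apply, Matrix.one_apply, Finset.prod_ite_zero, funext_iff]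
  simp

theorem tensorN_transpose {n : ℕ} (M : Fin n → Matrix (Fin 2) (Fin 2) ℂ) :
    (tensorN M).transpose = tensorN fun j => (M j).transpose := rfl

theorem tensorN_conjTranspose {n : ℕ} (M : Fin n → Matrix (Fin 2) (Fin 2) ℂ) :
    (tensorN M).conjTranspose = tensorN fun j => (M j).conjTranspose := by
  ext x y
  simp [tensorN]

theorem pauli_mul_self (a : Fin 4) : pauli a * pauli a = 1 := by
  fin_cases a <;> ext i j <;> fin_cases i <;> fin_cases j <;> simp [pauli, Matrix.mul_apply]

theorem pauli_conjTranspose (a : Fin 4) : (pauli a).conjTranspose = pauli a := by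
  fin_cases a <;> ext i j <;> fin_cases i <;> fin_cases j <;> simp [pauli]

/-- The sign `s` such that `σ_b σ_a σ_b = s σ_a`. -/
def pauliSign (b a : Fin 4) : ℂ := if a = 0 ∨ b = 0 ∨ a = b then 1 else -1

theorem pauli_mul_mul (b a : Fin 4) :
    pauli b * pauli a * pauli b = pauliSign b a • pauli a := by
  fin_cases b <;> fin_cases a <;> ext i j <;> fin_cases i <;> fin_cases j <;>
    simp [pauli, pauliSign, Matrix.mul_apply]

theorem pauli_two_mul_transpose_mul (a : Fin 4) :
    pauli 2 * (pauli a).transpose * pauli 2 = (if a ≠ 0 then -1 else 1 : ℂ) • pauli a := by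
  fin_cases a <;> ext i j <;> fin_cases i <;> fin_cases j <;>
    simp [pauli, Matrix.mul_apply, Matrix.vecMul, dotProduct]

theorem sum_pauli_mul_pauli (u v x y : Fin 2) :
    ∑ a, pauli a u v * pauli a x y / 2 = if u = y ∧ v = x then 1 else 0 := by
  have h0 : pauli 0 = 1 := rfl
  have h1 : pauli 1 = !![0, 1; 1, 0] := rfl
  have h2 : pauli 2 = !![0, -Complex.I; Complex.I, 0] := rfl
  have h3 : pauli 3 = !![1, 0; 0, -1] := rfl
  rw [Fin.sum_univ_four, h0, h1, h2, h3]
  fin_cases u <;> fin_cases v <;> fin_cases x <;> fin_cases y <;> norm_num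

/-- The weights expressing the single-qubit depolarizing map as a mixture of Pauli conjugations. -/
noncomputable def depolWeight (r : ℝ) (b : Fin 4) : ℝ :=
  if b = 0 then (1 + 3 * r) / 4 else (1 - r) / 4

theorem sum_depolWeight (r : ℝ) : ∑ b, depolWeight r b = 1 := by
  simp [depolWeight, Fin.sum_univ_four]
  ring

theorem sum_depolWeight_mul_pauliSign (r : ℝ) (a : Fin 4) :
    ∑ b, (depolWeight r b : ℂ) * pauliSign b a = if a ≠ 0 then (r : ℂ) else 1 := by
  fin_cases a <;> simp [depolWeight, pauliSign, Fin.sum_univ_four] <;> ring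

theorem depolWeight_nonneg {r : ℝ} (h0 : 0 ≤ r) (h1 : r ≤ 1) (b : Fin 4) :
    0 ≤ depolWeight r b := by
  unfold depolWeight
  split_ifs <;> linarith

theorem pow_pweight {n : ℕ} (α : Fin n → Fin 4) (c : ℂ) :
    c ^ pweight α = ∏ j, if α j ≠ 0 then c else 1 := by
  simp [pweight, Finset.prod_ite]

theorem pauliN_mul_mul (n : ℕ) (β α : Fin n → Fin 4) :
    pauliN n β * pauliN n α * pauliN n β = (∏ j, pauliSign (β j) (α j)) • pauliN n α := by
  simp only [pauliN_eq_tensorN, tensorN_mul, pauli_mul_mul, tensorN_smul]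

theorem pauliN_two_mul_transpose_mul (n : ℕ) (α : Fin n → Fin 4) :
    pauliN n (fun _ => 2) * (pauliN n α).transpose * pauliN n (fun _ => 2)
      = (-1 : ℂ) ^ pweight α • pauliN n α := by
  simp only [pauliN_eq_tensorN, tensorN_transpose, tensorN_mul, pauli_two_mul_transpose_mul,
    tensorN_smul, pow_pweight]

theorem sum_pauliCoeff_smul_pauliN {n : ℕ} (A : Matrix (QubitIdx n) (QubitIdx n) ℂ) :
    ∑ α, pauliCoeff A α • pauliN n α = A := by
  have key : ∀ u v x y : QubitIdx n,
      ∑ α, pauliN n α u v * pauliN n α x y / 2 ^ n = if u = y ∧ v = x then 1 else 0 := by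
    intro u v x y
    calc _ = ∑ α : Fin n → Fin 4, ∏ j, pauli (α j) (u j) (v j) * pauli (α j) (x j) (y j) / 2 := by
          refine Finset.sum_congr rfl fun α _ => ?_
          simp [pauliN, Finset.prod_mul_distrib, Finset.prod_div_distrib]
      _ = ∏ j, ∑ a, pauli a (u j) (v j) * pauli a (x j) (y j) / 2 := by
          rw [Finset.prod_univ_sum, Fintype.piFinset_univ]
      _ = _ := by
          simp only [sum_pauli_mul_pauli, Finset.prod_ite_zero, Finset.prod_const_one, funext_iff,
            Finset.mem_univ, true_implies, forall_and]
  ext x y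
  calc _ = ∑ α, ∑ u, ∑ v, A v u * (pauliN n α u v * pauliN n α x y / 2 ^ n) := by
        simp only [Matrix.sum_apply, Matrix.smul_apply, pauliCoeff, Matrix.trace, Matrix.diag,
          Matrix.mul_apply, smul_eq_mul, Finset.sum_div, Finset.sum_mul]
        refine Finset.sum_congr rfl fun α _ => Finset.sum_congr rfl fun u _ =>
          Finset.sum_congr rfl fun v _ => ?_
        ring
    _ = ∑ u, ∑ v, A v u * if u = y ∧ v = x then 1 else 0 := by
        rw [Finset.sum_comm]
        refine Finset.sum_congr rfl fun u _ => ?_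
        rw [Finset.sum_comm]
        refine Finset.sum_congr rfl fun v _ => ?_
        rw [← Finset.mul_sum, key]
    _ = _ := by simp [ite_and]

/-- The noise operator `T_z(A) = ∑_α z ^ |α| Â_α σ_α`. -/
noncomputable def noiseOp {n : ℕ} (z : ℂ) (A : Matrix (QubitIdx n) (QubitIdx n) ℂ) :
    Matrix (QubitIdx n) (QubitIdx n) ℂ :=
  ∑ α, (z ^ pweight α * pauliCoeff A α) • pauliN n α

theorem noiseOp_eq_sum_conj {n : ℕ} (r : ℝ) (A : Matrix (QubitIdx n) (QubitIdx n) ℂ) :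
    noiseOp r A
      = ∑ β, ((∏ j, depolWeight r (β j) : ℝ) : ℂ) • (pauliN n β * A * pauliN n β) := by
  conv_rhs => rw [← sum_pauliCoeff_smul_pauliN A]
  simp only [Finset.mul_sum, Finset.sum_mul, Finset.smul_sum, Matrix.mul_smul, Matrix.smul_mul,
    pauliN_mul_mul, smul_smul]
  rw [Finset.sum_comm, noiseOp]
  refine Finset.sum_congr rfl fun α _ => ?_
  rw [← Finset.sum_smul, pow_pweight]
  congr 1
  simp only [← sum_depolWeight_mul_pauliSign]
  rw [Finset.prod_univ_sum, Fintype.piFinset_univ, Finset.sum_mul]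
  refine Finset.sum_congr rfl fun β _ => ?_
  rw [Finset.prod_mul_distrib]
  push_cast
  ring

theorem noiseOp_neg {n : ℕ} (z : ℂ) (A : Matrix (QubitIdx n) (QubitIdx n) ℂ) :
    noiseOp (-z) A
      = pauliN n (fun _ => 2) * (noiseOp z A).transpose * pauliN n (fun _ => 2) := by
  simp only [noiseOp, Matrix.transpose_sum, Matrix.transpose_smul, Finset.mul_sum, Finset.sum_mul,
    Matrix.mul_smul, Matrix.smul_mul, pauliN_two_mul_transpose_mul, smul_smul]
  refine Finset.sum_congr rfl fun α _ => ?_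
  rw [neg_pow]
  congr 1
  ring

theorem sum_pow_smul_radProj {n d : ℕ} {A : Matrix (QubitIdx n) (QubitIdx n) ℂ}
    (hA : DegLE A d) (z : ℂ) :
    ∑ k ∈ Finset.range (d + 1), z ^ k • radProj k A = noiseOp z A := by
  simp only [radProj, Finset.sum_filter, Finset.smul_sum, noiseOp]
  rw [Finset.sum_comm]
  refine Finset.sum_congr rfl fun α _ => ?_
  simp only [smul_ite, smul_zero, smul_smul, Finset.sum_ite_eq, Finset.mem_range]
  split_ifs with h
  · rfl
  · rw [hA α (by omega)]; simp

section NoiseNorm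

open scoped Matrix.Norms.L2Operator

theorem norm_pauliN_le_one (n : ℕ) (α : Fin n → Fin 4) : ‖pauliN n α‖ ≤ 1 := by
  have h1 : star (pauliN n α) = pauliN n α := by
    simp only [Matrix.star_eq_conjTranspose, pauliN_eq_tensorN, tensorN_conjTranspose,
      pauli_conjTranspose]
  have h2 : pauliN n α * pauliN n α = 1 := by
    simp only [pauliN_eq_tensorN, tensorN_mul, pauli_mul_self, tensorN_one]
  exact (CStarRing.norm_of_mem_unitary
    (Unitary.mem_iff.2 ⟨by rw [h1, h2], by rw [h1, h2]⟩)).le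

theorem norm_pauliN_mul_mul_le {n : ℕ} (β : Fin n → Fin 4)
    (A : Matrix (QubitIdx n) (QubitIdx n) ℂ) : ‖pauliN n β * A * pauliN n β‖ ≤ ‖A‖ := by
  have h := norm_pauliN_le_one n β
  calc _ ≤ ‖pauliN n β‖ * ‖A‖ * ‖pauliN n β‖ :=
        (norm_mul_le _ _).trans (by gcongr; exact norm_mul_le _ _)
    _ ≤ 1 * ‖A‖ * 1 := by gcongr
    _ = ‖A‖ := by ring

theorem norm_noiseOp_le {n : ℕ} {r : ℝ} (hr : |r| ≤ 1)
    (A : Matrix (QubitIdx n) (QubitIdx n) ℂ) : ‖noiseOp r A‖ ≤ ‖A‖ := by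
  have hpos : ∀ {s : ℝ}, 0 ≤ s → s ≤ 1 → ‖noiseOp s A‖ ≤ ‖A‖ := by
    intro s h0 h1
    rw [noiseOp_eq_sum_conj]
    calc _ ≤ ∑ β : Fin n → Fin 4, (∏ j, depolWeight s (β j)) * ‖A‖ := by
          refine norm_sum_le_of_le _ fun β _ => ?_
          have hw : 0 ≤ ∏ j, depolWeight s (β j) :=
            Finset.prod_nonneg fun j _ => depolWeight_nonneg h0 h1 _
          rw [norm_smul, Complex.norm_of_nonneg hw]
          gcongr
          exact norm_pauliN_mul_mul_le β A
      _ = (∏ _j : Fin n, ∑ b, depolWeight s b) * ‖A‖ := by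
          rw [Finset.prod_univ_sum, Fintype.piFinset_univ, Finset.sum_mul]
      _ = ‖A‖ := by simp [sum_depolWeight]
  obtain ⟨h0, h1⟩ := abs_le.1 hr
  rcases le_total 0 r with h | h
  · exact hpos h h1
  · have hneg : noiseOp r A = noiseOp (-((-r : ℝ) : ℂ)) A := by simp
    rw [hneg, noiseOp_neg]
    exact (norm_pauliN_mul_mul_le _ _).trans
      ((Matrix.l2_opNorm_transpose_le _).trans (hpos (by linarith) (by linarith)))

end NoiseNorm

/-- For `0 ≤ k ≤ d ≤ n` and `A` of degree at most `d`,
`‖Rad_k(A)‖ ≤ (√2 + 1)^d ‖A‖`. -/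
theorem rademacher_projection_bound (n d k : ℕ) (hk : k ≤ d) (hd : d ≤ n)
    (A : Matrix (QubitIdx n) (QubitIdx n) ℂ) (hdeg : DegLE A d) :
    opNorm (radProj k A) ≤ (Real.sqrt 2 + 1) ^ d * opNorm A := by
  open scoped Matrix.Norms.L2Operator in
  change ‖radProj k A‖ ≤ (Real.sqrt 2 + 1) ^ d * ‖A‖
  refine norm_coeff_le_of_norm_sum_pow_smul_le (a := fun k => radProj k A) (fun z hz => ?_) hk
  refine norm_sum_pow_smul_le_of_norm_eq_one (a := fun k => radProj k A) (fun x hx => ?_) hz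
  rw [sum_pow_smul_radProj hdeg]
  exact norm_noiseOp_le hx A
end

section
/- Let K ≥ 3 be a prime, ω = e^{2πi/K}, and let X, Z ∈ M_K(ℂ) be the shift and clock matrices defined by X|j⟩ = |j+1 mod K⟩ and Z|j⟩ = ω^j |j⟩. Let Σ = {(0,1), (1,1), (2,1), …, (K−1,1), (1,0)} ⊂ ℤ_K × ℤ_K. For (s,t) ∈ Σ and z a K-th root of unity, let |e^{s,t}_z⟩ be the unit eigenvector of X^s Z^t with eigenvalue z, and for (s,t) = ((s_j,t_j))_{j∈[n]} ∈ Σ^n define the conditional expectation E_{s,t}(A) = ∑_{z ∈ Ω_K^n} |e^{s,t}_z⟩⟨e^{s,t}_z| A |e^{s,t}_z⟩⟨e^{s,t}_z| with |e^{s,t}_z⟩ = ⊗_{j∈[n]} |e^{s_j,t_j}_{z_j}⟩. Then for every A ∈ M_K(ℂ)^{⊗n} with Heisenberg–Weyl expansion A = ∑_{(a,b) ∈ ℤ_K^n × ℤ_K^n} Â(a,b) X^a Z^b, one has (1/(K+1)^n) ∑_{(s,t) ∈ Σ^n} E_{s,t}(A) = ∑_{(a,b)} (K+1)^{−|(a,b)|}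 Â(a,b) X^a Z^b, where |(a,b)| = #{j ∈ [n] : (a_j, b_j) ≠ (0,0)} and X^a Z^b = ⊗_{j∈[n]} X^{a_j} Z^{b_j}. -/
/-- `ω = e^{2πi/K}`. -/
noncomputable def omegaK (K : ℕ) : ℂ := Complex.exp (2 * Real.pi * Complex.I / K)

/-- The shift matrix `X|j⟩ = |j+1⟩` on `ℂ^K`. -/
noncomputable def shiftX (K : ℕ) : Matrix (ZMod K) (ZMod K) ℂ :=
  Matrix.of fun i j => if i = j + 1 then 1 else 0

/-- The clock matrix `Z|j⟩ = ω^j |j⟩` on `ℂ^K`. -/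
noncomputable def clockZ (K : ℕ) : Matrix (ZMod K) (ZMod K) ℂ :=
  Matrix.of fun i j => if i = j then omegaK K ^ i.val else 0

/-- The Heisenberg–Weyl monomial `X^a Z^b = ⊗_j X^{a_j} Z^{b_j}` on `(ℂ^K)^{⊗n}`. -/
noncomputable def HW (K : ℕ) [NeZero K] (n : ℕ) (a b : Fin n → ZMod K) :
    Matrix (Fin n → ZMod K) (Fin n → ZMod K) ℂ :=
  Matrix.of fun x y => ∏ j, (shiftX K ^ (a j).val * clockZ K ^ (b j).val) (x j) (y j)

/-- `|(a,b)| = #{j : (a_j, b_j) ≠ (0,0)}`. -/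
def hwWeight (K : ℕ) [NeZero K] {n : ℕ}
    (ab : (Fin n → ZMod K) × (Fin n → ZMod K)) : ℕ :=
  (Finset.univ.filter fun j => (ab.1 j, ab.2 j) ≠ ((0 : ZMod K), (0 : ZMod K))).card

/-- The set of generators `Σ = {(0,1), (1,1), …, (K−1,1), (1,0)}`. -/
noncomputable def SigmaSet (K : ℕ) [NeZero K] : Finset (ZMod K × ZMod K) :=
  insert (1, 0) (Finset.univ.image fun s : ZMod K => (s, 1))

/-- The tensor product of the rank-one projections `|e^{s_j,t_j}_{z_j}⟩⟨e^{s_j,t_j}_{z_j}|`,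
where the eigenvectors are given by the family `v`. -/
noncomputable def projTens (K : ℕ) [NeZero K] {n : ℕ}
    (v : ZMod K × ZMod K → ZMod K → ZMod K → ℂ)
    (st : Fin n → ZMod K × ZMod K) (z : Fin n → ZMod K) :
    Matrix (Fin n → ZMod K) (Fin n → ZMod K) ℂ :=
  Matrix.of fun x y => ∏ j, v (st j) (z j) (x j) * starRingEnd ℂ (v (st j) (z j) (y j))

/-- The conditional expectation `E_{s,t}(A) = ∑_z |e^{s,t}_z⟩⟨e^{s,t}_z| A |e^{s,t}_z⟩⟨e^{s,t}_z|`. -/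
noncomputable def condExpQ (K : ℕ) [NeZero K] {n : ℕ}
    (v : ZMod K × ZMod K → ZMod K → ZMod K → ℂ)
    (st : Fin n → ZMod K × ZMod K)
    (A : Matrix (Fin n → ZMod K) (Fin n → ZMod K) ℂ) :
    Matrix (Fin n → ZMod K) (Fin n → ZMod K) ℂ :=
  ∑ z : Fin n → ZMod K, projTens K v st z * A * projTens K v st z

open scoped Matrix ComplexConjugate

section SingleSite

variable {K : ℕ} [NeZero K]

theorem omegaK_pow_val (x : ZMod K) : omegaK K ^ x.val = ZMod.stdAddChar x := by
  rw [ZMod.stdAddChar_apply, ZMod.toCircle_apply, omegaK, ← Complex.exp_nat_mul]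
  congr 1
  ring

theorem shiftX_pow_apply (m : ℕ) (i j : ZMod K) :
    (shiftX K ^ m) i j = if i = j + m then 1 else 0 := by
  induction m generalizing i j with
  | zero => simp [Matrix.one_apply]
  | succ m ih =>
    rw [pow_succ, Matrix.mul_apply]
    simp only [ih]
    simp only [shiftX, Matrix.of_apply, mul_ite, mul_one, mul_zero, Finset.sum_ite_eq',
      Finset.mem_univ, if_true]
    rw [add_assoc, add_comm 1, Nat.cast_succ]

theorem clockZ_pow (m : ℕ) :
    clockZ K ^ m = Matrix.diagonal fun i => (ZMod.stdAddChar i : ℂ) ^ m := by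
  have h : clockZ K = Matrix.diagonal fun i => (ZMod.stdAddChar i : ℂ) := by
    ext i j
    simp [clockZ, Matrix.diagonal_apply, omegaK_pow_val]
  rw [h, Matrix.diagonal_pow]
  rfl

/-- The one-site Heisenberg–Weyl monomial `X^a Z^b`, written entrywise. -/
noncomputable def weyl (a b : ZMod K) : Matrix (ZMod K) (ZMod K) ℂ :=
  Matrix.of fun i j => if i = j + a then ZMod.stdAddChar (b * j) else 0

theorem shiftX_pow_mul_clockZ_pow (a b : ZMod K) :
    shiftX K ^ a.val * clockZ K ^ b.val = weyl a b := by
  ext i j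
  rw [clockZ_pow, Matrix.mul_diagonal, shiftX_pow_apply, weyl, Matrix.of_apply,
    ZMod.natCast_zmod_val, ← AddChar.map_nsmul_eq_pow, nsmul_eq_mul, ZMod.natCast_zmod_val]
  split_ifs <;> simp

theorem weyl_zero : weyl (0 : ZMod K) 0 = 1 := by
  ext i j
  simp [weyl, Matrix.one_apply]

theorem weyl_mul (a b c d : ZMod K) :
    weyl a b * weyl c d = (ZMod.stdAddChar (b * c) : ℂ) • weyl (a + c) (b + d) := by
  ext i j
  simp only [weyl, Matrix.mul_apply, Matrix.smul_apply, Matrix.of_apply, mul_ite, mul_zero,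
    Finset.sum_ite_eq', Finset.mem_univ, if_true, smul_eq_mul, ite_mul, zero_mul]
  rw [show j + c + a = j + (a + c) by ring]
  split_ifs
  · rw [← AddChar.map_add_eq_mul, ← AddChar.map_add_eq_mul]
    congr 1
    ring
  · rfl

theorem weyl_mul_comm (a b s t : ZMod K) :
    weyl s t * weyl a b = (ZMod.stdAddChar (t * a - b * s) : ℂ) • (weyl a b * weyl s t) := by
  rw [weyl_mul, weyl_mul, smul_smul, ← AddChar.map_add_eq_mul, sub_add_cancel, add_comm a,
    add_comm b]

theorem conj_stdAddChar (x : ZMod K) :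
    conj (ZMod.stdAddChar x : ℂ) = ZMod.stdAddChar (-x) :=
  (AddChar.map_neg_eq_conj _ x).symm

theorem weyl_conjTranspose_mul_self (a b : ZMod K) : (weyl a b)ᴴ * weyl a b = 1 := by
  ext i j
  simp only [weyl, Matrix.mul_apply, Matrix.conjTranspose_apply, Matrix.of_apply, mul_ite,
    mul_zero, Finset.sum_ite_eq', Finset.mem_univ, if_true, Matrix.one_apply, add_left_inj]
  by_cases h : i = j
  · subst h
    rw [if_pos rfl, if_pos rfl, ← starRingEnd_apply, conj_stdAddChar, ← AddChar.map_add_eq_mul]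
    simp
  · rw [if_neg (Ne.symm h), if_neg h]
    simp

/-- A family of vectors `w k`, as the columns of a matrix. -/
def colMatrix (w : ZMod K → ZMod K → ℂ) : Matrix (ZMod K) (ZMod K) ℂ :=
  Matrix.of fun i k => w k i

/-- Coefficients of a Weyl monomial between eigenvectors of another one vanish unless the
eigenvalues match the commutation phase. -/
theorem colMatrix_sandwich_eq_zero {s t : ZMod K} {w : ZMod K → ZMod K → ℂ}
    (hw : ∀ k, weyl s t *ᵥ w k = (ZMod.stdAddChar k : ℂ) • w k) (a b : ZMod K) {k l : ZMod K}
    (hkl : k ≠ t * a - b * s + l) :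
    ((colMatrix w)ᴴ * weyl a b * colMatrix w) k l = 0 := by
  set D : Matrix (ZMod K) (ZMod K) ℂ := Matrix.diagonal fun k => (ZMod.stdAddChar k : ℂ)
    with hD
  set V := colMatrix w with hV
  set U := weyl s t with hU
  have hUV : U * V = V * D := by
    ext i k
    have := congrFun (hw k) i
    rw [hD, Matrix.mul_diagonal, mul_comm]
    simpa [Matrix.mul_apply, Matrix.mulVec, dotProduct, hV, colMatrix] using this
  have hDD : D * Dᴴ = 1 := by
    rw [hD, Matrix.diagonal_conjTranspose, Matrix.diagonal_mul_diagonal, ← Matrix.diagonal_one]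
    congr 1
    funext k
    rw [Pi.star_apply, ← starRingEnd_apply, conj_stdAddChar, ← AddChar.map_add_eq_mul]
    simp
  have hVU : Vᴴ * U = D * Vᴴ := by
    have h := congrArg Matrix.conjTranspose hUV
    rw [Matrix.conjTranspose_mul, Matrix.conjTranspose_mul] at h
    calc Vᴴ * U = D * (Dᴴ * Vᴴ) * U := by rw [← Matrix.mul_assoc D, hDD, Matrix.one_mul]
      _ = D * Vᴴ := by
        rw [← h, Matrix.mul_assoc, Matrix.mul_assoc, weyl_conjTranspose_mul_self, Matrix.mul_one]
  have key : D * (Vᴴ * weyl a b * V) =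
      (ZMod.stdAddChar (t * a - b * s) : ℂ) • ((Vᴴ * weyl a b * V) * D) := by
    calc D * (Vᴴ * weyl a b * V) = Vᴴ * (U * weyl a b) * V := by
          simp only [← Matrix.mul_assoc, hVU]
      _ = _ := by
        rw [hU, weyl_mul_comm, Matrix.mul_smul, Matrix.smul_mul, ← hU]
        simp only [Matrix.mul_assoc, hUV]
  have h := congrFun (congrFun key k) l
  rw [Matrix.smul_apply, hD, Matrix.diagonal_mul, Matrix.mul_diagonal, smul_eq_mul,
    mul_left_comm, ← AddChar.map_add_eq_mul, mul_comm] at h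
  by_contra h0
  exact hkl (ZMod.injective_stdAddChar (mul_left_cancel₀ h0 h))

/-- The rank-one matrix `|w⟩⟨w|`. -/
def rankOne (w : ZMod K → ℂ) : Matrix (ZMod K) (ZMod K) ℂ :=
  Matrix.of fun x y => w x * conj (w y)

theorem sum_rankOne_sandwich (w : ZMod K → ZMod K → ℂ) (M : Matrix (ZMod K) (ZMod K) ℂ) :
    ∑ k, rankOne (w k) * M * rankOne (w k) =
      colMatrix w * Matrix.diagonal (fun k => ((colMatrix w)ᴴ * M * colMatrix w) k k) *
        (colMatrix w)ᴴ := by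
  ext x y
  rw [Matrix.sum_apply, Matrix.mul_apply]
  refine Finset.sum_congr rfl fun k _ => ?_
  rw [Matrix.mul_diagonal]
  simp only [Matrix.mul_apply, rankOne, colMatrix, Matrix.of_apply, Matrix.conjTranspose_apply,
    starRingEnd_apply, Finset.sum_mul, Finset.mul_sum]
  refine Finset.sum_congr rfl fun i _ => Finset.sum_congr rfl fun j _ => ?_
  ring

/-- The one-site conditional expectation keeps the Weyl monomials commuting with the generator
and kills the others. -/
theorem sum_rankOne_weyl {s t : ZMod K} {w : ZMod K → ZMod K → ℂ}
    (hw : ∀ k, weyl s t *ᵥ w k = (ZMod.stdAddChar k : ℂ) • w k)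
    (hn : ∀ k, ∑ i, ‖w k i‖ ^ 2 = 1) (a b : ZMod K) :
    ∑ k, rankOne (w k) * weyl a b * rankOne (w k) =
      if t * a = b * s then weyl a b else 0 := by
  have hVV : (colMatrix w)ᴴ * colMatrix w = 1 := by
    ext k l
    by_cases h : k = l
    · subst h
      rw [Matrix.one_apply_eq, Matrix.mul_apply]
      have h := congrArg (fun r : ℝ => (r : ℂ)) (hn k)
      push_cast at h
      rw [← h]
      refine Finset.sum_congr rfl fun i _ => ?_
      rw [← Complex.conj_mul']
      rfl
    · rw [Matrix.one_apply_ne h]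
      have := colMatrix_sandwich_eq_zero hw 0 0 (k := k) (l := l) (by simpa using h)
      rwa [weyl_zero, Matrix.mul_one] at this
  have hVV' := mul_eq_one_comm.mp hVV
  rw [sum_rankOne_sandwich]
  split_ifs with h
  · have hd : Matrix.diagonal (fun k => ((colMatrix w)ᴴ * weyl a b * colMatrix w) k k) =
        (colMatrix w)ᴴ * weyl a b * colMatrix w := by
      ext k l
      by_cases hkl : k = l
      · subst hkl
        rw [Matrix.diagonal_apply_eq]
      · rw [Matrix.diagonal_apply_ne _ hkl,
          colMatrix_sandwich_eq_zero hw a b (by simpa [h] using hkl)]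
    rw [hd, Matrix.mul_assoc, Matrix.mul_assoc, hVV', Matrix.mul_one, ← Matrix.mul_assoc, hVV',
      Matrix.one_mul]
  · have hd : (fun k => ((colMatrix w)ᴴ * weyl a b * colMatrix w) k k) = 0 := by
      funext k
      refine colMatrix_sandwich_eq_zero hw a b fun hk => h ?_
      exact sub_eq_zero.mp (right_eq_add.mp hk)
    rw [hd]
    simp

theorem sum_SigmaSet (f : ZMod K × ZMod K → ℂ) (hK : 1 < K) :
    ∑ p ∈ SigmaSet K, f p = f (1, 0) + ∑ s : ZMod K, f (s, 1) := by
  have : Fact (1 < K) := ⟨hK⟩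
  rw [SigmaSet, Finset.sum_insert (by simp), Finset.sum_image fun _ _ _ _ h => congrArg Prod.fst h]

/-- A nonzero Weyl monomial commutes with exactly one generator in `Σ`, the identity with all of
them. -/
theorem sum_SigmaSet_commute (hK : K.Prime) (a b : ZMod K) :
    ∑ p ∈ SigmaSet K, (if p.2 * a = b * p.1 then (1 : ℂ) else 0) =
      if (a, b) = (0, 0) then (K : ℂ) + 1 else 1 := by
  have : Fact K.Prime := ⟨hK⟩
  rw [sum_SigmaSet _ hK.one_lt]
  simp only [zero_mul, mul_one, one_mul, Prod.mk.injEq]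
  by_cases hb : b = 0
  · subst hb
    by_cases ha : a = 0 <;> simp [ha, ZMod.card, add_comm]
  · have h : ∀ s : ZMod K, (a = b * s) ↔ (s = a / b) := fun s => by
      rw [eq_div_iff hb, mul_comm b, eq_comm]
    simp [hb, Ne.symm hb, h]

end SingleSite

section Tensor

variable {ι m R : Type*} [Fintype ι] [CommSemiring R]

/-- The tensor product of a family of square matrices. -/
def tensorMatrix (M : ι → Matrix m m R) : Matrix (ι → m) (ι → m) R :=
  Matrix.of fun x y => ∏ j, M j (x j) (y j)

theorem tensorMatrix_mul [Fintype m] [DecidableEq ι] (M N : ι → Matrix m m R) :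
    tensorMatrix M * tensorMatrix N = tensorMatrix fun j => M j * N j := by
  ext x y
  simp only [tensorMatrix, Matrix.mul_apply, Matrix.of_apply, ← Finset.prod_mul_distrib]
  exact (Fintype.prod_sum fun j k => M j (x j) k * N j k (y j)).symm

theorem sum_tensorMatrix [DecidableEq ι] {κ : Type*} (s : ι → Finset κ)
    (M : ι → κ → Matrix m m R) :
    ∑ z ∈ Fintype.piFinset s, tensorMatrix (fun j => M j (z j)) =
      tensorMatrix fun j => ∑ k ∈ s j, M j k := by
  ext x y
  simp only [tensorMatrix, Matrix.sum_apply, Matrix.of_apply]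
  exact (Finset.prod_univ_sum s fun j k => M j k (x j) (y j)).symm

theorem tensorMatrix_smul (r : ι → R) (M : ι → Matrix m m R) :
    tensorMatrix (fun j => r j • M j) = (∏ j, r j) • tensorMatrix M := by
  ext x y
  simp [tensorMatrix, Finset.prod_mul_distrib]

end Tensor

theorem HW_eq_tensorMatrix {K : ℕ} [NeZero K] {n : ℕ} (a b : Fin n → ZMod K) :
    HW K n a b = tensorMatrix fun j => weyl (a j) (b j) := by
  simp only [HW, shiftX_pow_mul_clockZ_pow]
  rfl

theorem condExpQ_HW {K : ℕ} [NeZero K] {n : ℕ}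
    (v : ZMod K × ZMod K → ZMod K → ZMod K → ℂ) (st : Fin n → ZMod K × ZMod K)
    (a b : Fin n → ZMod K) :
    condExpQ K v st (HW K n a b) =
      tensorMatrix fun j =>
        ∑ k, rankOne (v (st j) k) * weyl (a j) (b j) * rankOne (v (st j) k) := by
  have h : ∀ z, projTens K v st z = tensorMatrix fun j => rankOne (v (st j) (z j)) :=
    fun z => rfl
  simp only [condExpQ, h, HW_eq_tensorMatrix, tensorMatrix_mul]
  rw [← sum_tensorMatrix, Fintype.piFinset_univ]

theorem condExpQ_sum_smul {K : ℕ} [NeZero K] {n : ℕ} {κ : Type*} (s : Finset κ)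
    (v : ZMod K × ZMod K → ZMod K → ZMod K → ℂ) (st : Fin n → ZMod K × ZMod K) (c : κ → ℂ)
    (M : κ → Matrix (Fin n → ZMod K) (Fin n → ZMod K) ℂ) :
    condExpQ K v st (∑ i ∈ s, c i • M i) = ∑ i ∈ s, c i • condExpQ K v st (M i) := by
  simp only [condExpQ, Finset.mul_sum, Finset.sum_mul, Matrix.mul_smul, Matrix.smul_mul,
    Finset.smul_sum]
  exact Finset.sum_comm

theorem sum_condExpQ_HW {K : ℕ} [NeZero K] (hK : K.Prime) {n : ℕ}
    {v : ZMod K × ZMod K → ZMod K → ZMod K → ℂ}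
    (hv : ∀ p ∈ SigmaSet K, ∀ k : ZMod K,
      (∑ i, ‖v p k i‖ ^ 2 = 1) ∧
      (shiftX K ^ p.1.val * clockZ K ^ p.2.val).mulVec (v p k)
        = (omegaK K ^ k.val) • v p k)
    (a b : Fin n → ZMod K) :
    ∑ st ∈ Fintype.piFinset (fun _ : Fin n => SigmaSet K), condExpQ K v st (HW K n a b) =
      (∏ j, if (a j, b j) = (0, 0) then (K : ℂ) + 1 else 1) • HW K n a b := by
  simp only [condExpQ_HW]
  rw [sum_tensorMatrix (fun _ => SigmaSet K) fun j p =>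
    ∑ k, rankOne (v p k) * weyl (a j) (b j) * rankOne (v p k), HW_eq_tensorMatrix,
    ← tensorMatrix_smul]
  congr 1
  funext j
  rw [← sum_SigmaSet_commute hK, Finset.sum_smul]
  refine Finset.sum_congr rfl fun p hp => ?_
  simp only [shiftX_pow_mul_clockZ_pow, omegaK_pow_val] at hv
  rw [sum_rankOne_weyl (fun k => (hv p hp k).2) fun k => (hv p hp k).1]
  split_ifs <;> simp

/-- Let `K ≥ 3` be prime, and for each `(s,t) ∈ Σ` and `z = ω^k` let
`v (s,t) k` be a unit eigenvector of `X^s Z^t` with eigenvalue `ω^k`. Then for every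
`A = ∑_{(a,b)} Â(a,b) X^a Z^b` on `(ℂ^K)^{⊗n}`,
`(1/(K+1)^n) ∑_{(s,t) ∈ Σ^n} E_{s,t}(A) = ∑_{(a,b)} (K+1)^{−|(a,b)|} Â(a,b) X^a Z^b`. -/
theorem qudit_average_condExp (K : ℕ) [NeZero K] (hK : Nat.Prime K) (hK3 : 3 ≤ K)
    (n : ℕ) (hn : 1 ≤ n)
    (v : ZMod K × ZMod K → ZMod K → ZMod K → ℂ)
    (hv : ∀ p ∈ SigmaSet K, ∀ k : ZMod K,
      (∑ i, ‖v p k i‖ ^ 2 = 1) ∧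
      (shiftX K ^ p.1.val * clockZ K ^ p.2.val).mulVec (v p k)
        = (omegaK K ^ k.val) • v p k)
    (A : Matrix (Fin n → ZMod K) (Fin n → ZMod K) ℂ)
    (c : (Fin n → ZMod K) × (Fin n → ZMod K) → ℂ)
    (hA : A = ∑ ab : (Fin n → ZMod K) × (Fin n → ZMod K), c ab • HW K n ab.1 ab.2) :
    (((K : ℂ) + 1) ^ n)⁻¹ • ∑ st ∈ Fintype.piFinset (fun _ : Fin n => SigmaSet K),
        condExpQ K v st A
      = ∑ ab : (Fin n → ZMod K) × (Fin n → ZMod K),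
          (((K : ℂ) + 1) ^ hwWeight K ab)⁻¹ • c ab • HW K n ab.1 ab.2 := by
  have hK0 : (K : ℂ) + 1 ≠ 0 := Nat.cast_add_one_ne_zero K
  subst hA
  simp only [condExpQ_sum_smul]
  rw [Finset.sum_comm, Finset.smul_sum]
  refine Finset.sum_congr rfl fun ab _ => ?_
  rw [← Finset.smul_sum, sum_condExpQ_HW hK hv, smul_comm (c ab), smul_smul]
  congr 1
  have hcard := Finset.card_filter_add_card_filter_not (s := (Finset.univ : Finset (Fin n)))
    fun j => (ab.1 j, ab.2 j) = ((0 : ZMod K), (0 : ZMod K))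
  rw [Finset.card_univ, Fintype.card_fin] at hcard
  rw [Finset.prod_ite, Finset.prod_const, Finset.prod_const_one, mul_one, hwWeight]
  nth_rw 1 [← hcard]
  rw [pow_add, mul_inv, mul_right_comm, inv_mul_cancel₀ (pow_ne_zero _ hK0), one_mul]
end
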